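/- Let G(V,E,f⁰) be a graph with flags. Then for every spanning c-subgraph A ⋐ G one has f(A) = |f⁰| + 2(|E| − |E_A|); consequently 𝒯_G(x,y,t) = t^{|f⁰|} · t^{2n(G)} · T_G( (x−1)t² + 1 , (y−1+t²)/t² ), where T is the classical Tutte polynomial, and in particular 𝒯_G(x,y,1) = T_G(x,y). -/

import Mathlib

/-!
# Statement 5

A graph with flags is modelled by finite vertex and edge sets, an incidence map
sending each edge to its (ordered pair of) end vertices, and the number
`flags = |f⁰|` of additional flags.  A spanning c-subgraph is determined by its
edge set `A`; it has all vertices, all flags of `f⁰`, plus two flags for each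
cut edge of `E ∖ A`, so its number of flags is `|f⁰| + 2(|E| - |A|)`.
-/

/-- A graph with flags `G(V, E, f⁰)`: finite vertex and edge sets, each edge
incident to one or two end vertices (recorded as an ordered pair; a self-loop
has both components equal), together with a number `flags = |f⁰|` of
additional flags (half-edges attached to vertices). -/
structure FlagGraph where
  V : Type
  E : Type
  vFin : Fintype V
  eFin : Fintype E
  eDec : DecidableEq E
  ends : E → V × V
  flags : ℕ

attribute [instance] FlagGraph.vFin FlagGraph.eFin FlagGraph.eDec

namespace FlagGraph

variable (G : FlagGraph)

/-- `u` and `v` are joined by some edge of the spanning c-subgraph with edge set `A`. -/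
def adj (A : Finset G.E) (u v : G.V) : Prop :=
  ∃ e ∈ A, G.ends e = (u, v) ∨ G.ends e = (v, u)

/-- `k(A)`: the number of connected components of the spanning c-subgraph with
edge set `A` (it has all the vertices of `G`). -/
noncomputable def kc (A : Finset G.E) : ℕ :=
  Nat.card (Quot (G.adj A))

/-- `r(G) - r(A) = k(A) - k(G)`, where `r(A) = |V| - k(A)` is the rank. -/
noncomputable def corank (A : Finset G.E) : ℕ :=
  G.kc A - G.kc Finset.univ

/-- The nullity `n(A) = |E_A| + k(A) - |V|`. -/
noncomputable def nullity (A : Finset G.E) : ℕ :=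
  A.card + G.kc A - Fintype.card G.V

/-- `f(A)`: the number of flags of the spanning c-subgraph `A`, namely the
flags of `f⁰` together with the two flags obtained by cutting each edge not
in `A`. -/
def nflags (A : Finset G.E) : ℕ :=
  G.flags + 2 * (Fintype.card G.E - A.card)

/-- The Tutte polynomial of a graph with flags,
`𝒯_G(x,y,t) = Σ_{A ⋐ G} (x-1)^{r(G)-r(A)} (y-1)^{n(A)} t^{f(A)}`. -/
noncomputable def T {K : Type*} [CommRing K] (x y t : K) : K :=
  ∑ A : Finset G.E,
    (x - 1) ^ G.corank A * (y - 1) ^ G.nullity A * t ^ G.nflags A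

/-- A self-loop: both ends of `e` are incident to the same vertex. -/
def IsSelfLoop (e : G.E) : Prop := (G.ends e).1 = (G.ends e).2

/-- A bridge: removing `e` disconnects a component. -/
def IsBridge (e : G.E) : Prop :=
  G.kc (Finset.univ.erase e) = G.kc Finset.univ + 1

/-- A regular (ordinary) edge: neither a bridge nor a self-loop. -/
def IsRegular (e : G.E) : Prop := ¬ G.IsSelfLoop e ∧ ¬ G.IsBridge e

/-- The graph `G − e` obtained by deleting the edge `e`. -/
def del (e : G.E) : FlagGraph where
  V := G.V
  E := {e' : G.E // e' ≠ e}
  vFin := G.vFin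
  eFin := by infer_instance
  eDec := by infer_instance
  ends := fun e' => G.ends e'.1
  flags := G.flags

/-- The graph `G ∨ e` obtained by cutting the edge `e`: `e` is removed and two
flags are attached at its former end vertices. -/
def cut (e : G.E) : FlagGraph where
  V := G.V
  E := {e' : G.E // e' ≠ e}
  vFin := G.vFin
  eFin := by infer_instance
  eDec := by infer_instance
  ends := fun e' => G.ends e'.1
  flags := G.flags + 2

/-- The relation identifying the two end vertices of `e`. -/
def contractRel (e : G.E) (u v : G.V) : Prop :=
  u = (G.ends e).1 ∧ v = (G.ends e).2

open scoped Classical in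
/-- The graph `G/e` obtained by contracting the edge `e`: for a non-self-loop,
`e` is removed and its end vertices are identified into a single vertex
carrying all their remaining edges and flags; for a self-loop, `G/e := G − e`. -/
noncomputable def contract (e : G.E) : FlagGraph :=
  if G.IsSelfLoop e then G.del e
  else
    { V := Quot (G.contractRel e)
      E := {e' : G.E // e' ≠ e}
      vFin := @Fintype.ofFinite _
        (Finite.of_surjective (Quot.mk (G.contractRel e))
          (fun q => Quot.inductionOn q fun v => ⟨v, rfl⟩))
      eFin := by infer_instance
      eDec := by infer_instance
      ends := fun e' =>
        (Quot.mk (G.contractRel e) (G.ends e'.1).1,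
         Quot.mk (G.contractRel e) (G.ends e'.1).2)
      flags := G.flags }

end FlagGraph

namespace FlagGraph

/-- The classical Tutte polynomial
`T_G(x,y) = Σ_{A ⋐ G} (x-1)^{r(G)-r(A)} (y-1)^{n(A)}`. -/
noncomputable def Tclassical (G : FlagGraph) {K : Type*} [CommRing K] (x y : K) : K :=
  ∑ A : Finset G.E, (x - 1) ^ G.corank A * (y - 1) ^ G.nullity A

end FlagGraph

namespace FlagGraph

variable (G : FlagGraph)

theorem kc_anti {A B : Finset G.E} (h : A ⊆ B) : G.kc B ≤ G.kc A :=
  Nat.card_le_card_of_surjective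
    (Quot.map id fun _ _ ⟨e, he, h'⟩ => ⟨e, h he, h'⟩ : Quot (G.adj A) → Quot (G.adj B))
    fun q => Quot.inductionOn q fun v => ⟨Quot.mk _ v, rfl⟩

/-- Adding an edge merges at most two components. -/
theorem kc_le_kc_insert_add_one (e : G.E) (A : Finset G.E) :
    G.kc A ≤ G.kc (insert e A) + 1 := by
  classical
  set c₁ : Quot (G.adj A) := Quot.mk _ (G.ends e).1 with hc₁
  set c₂ : Quot (G.adj A) := Quot.mk _ (G.ends e).2 with hc₂
  let merge : Quot (G.adj A) → Quot (G.adj (insert e A)) :=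
    Quot.map id fun _ _ ⟨e', he', h'⟩ => ⟨e', Finset.mem_insert_of_mem he', h'⟩
  let split : Quot (G.adj (insert e A)) → Quot (G.adj A) :=
    Quot.lift (fun v => if Quot.mk (G.adj A) v = c₁ then c₂ else Quot.mk (G.adj A) v) <| by
      rintro u v ⟨e', he', h'⟩
      rcases Finset.mem_insert.1 he' with rfl | he'
      · rcases h' with h' | h' <;> simp only [h'] at hc₁ hc₂ <;> simp only [← hc₁, ← hc₂] <;>
          split_ifs <;> simp_all
      · have huv : Quot.mk (G.adj A) u = Quot.mk (G.adj A) v := Quot.sound ⟨e', he', h'⟩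
        simp only [huv]
  have split_merge (q : Quot (G.adj A)) (hq : q ≠ c₁) : split (merge q) = q := by
    induction q using Quot.inductionOn
    exact if_neg hq
  have inj : Function.Injective fun q => if q = c₁ then none else some (merge q) := by
    intro q q' h
    by_cases hq : q = c₁ <;> by_cases hq' : q' = c₁ <;> simp only [hq, hq', if_true, if_false,
      reduceCtorEq, Option.some.injEq] at h ⊢
    rw [← split_merge q hq, h, split_merge q' hq']
  simpa only [kc, Finite.card_option] using Nat.card_le_card_of_injective _ inj

theorem card_le_card_add_kc (A : Finset G.E) : Fintype.card G.V ≤ A.card + G.kc A := by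
  induction A using Finset.induction_on with
  | empty =>
    rw [Finset.card_empty, zero_add, ← Nat.card_eq_fintype_card]
    refine Nat.card_le_card_of_injective (Quot.mk (G.adj ∅)) ?_
    exact Function.LeftInverse.injective
      (g := Quot.lift id fun _ _ ⟨e, he, _⟩ => absurd he (Finset.notMem_empty e)) fun _ => rfl
  | insert e A he ih =>
    rw [Finset.card_insert_of_notMem he]
    have := G.kc_le_kc_insert_add_one e A
    omega

theorem nullity_univ_add_corank (A : Finset G.E) :
    G.nullity Finset.univ + G.corank A = G.nullity A + (Fintype.card G.E - A.card) := by
  have h₁ := G.card_le_card_add_kc A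
  have h₂ := G.card_le_card_add_kc Finset.univ
  have h₃ := G.kc_anti A.subset_univ
  have h₄ := A.card_le_univ
  rw [Finset.card_univ] at h₂
  simp only [nullity, corank, Finset.card_univ]
  omega

end FlagGraph

/-- For a graph with flags `G(V,E,f⁰)`:
every spanning c-subgraph `A ⋐ G` has `f(A) = |f⁰| + 2(|E| - |E_A|)` flags;
consequently
`𝒯_G(x,y,t) = t^{|f⁰|} t^{2 n(G)} T_G((x-1)t² + 1, (y-1+t²)/t²)`,
where `T` is the classical Tutte polynomial, and in particular
`𝒯_G(x,y,1) = T_G(x,y)`. -/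
theorem tutte_flags_vs_classical_tutte
    {K : Type*} [Field K] (x y t : K) (ht : t ≠ 0) (G : FlagGraph) :
    (∀ A : Finset G.E,
        G.nflags A = G.flags + 2 * (Fintype.card G.E - A.card)) ∧
    G.T x y t
      = t ^ G.flags * t ^ (2 * G.nullity Finset.univ)
          * G.Tclassical ((x - 1) * t ^ 2 + 1) ((y - 1 + t ^ 2) / t ^ 2) ∧
    G.T x y 1 = G.Tclassical x y := by
  refine ⟨fun _ => rfl, ?_, by simp [FlagGraph.T, FlagGraph.Tclassical]⟩
  rw [FlagGraph.T, FlagGraph.Tclassical, Finset.mul_sum]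
  refine Finset.sum_congr rfl fun A _ => ?_
  have hy : (y - 1 + t ^ 2) / t ^ 2 - 1 = (y - 1) / t ^ 2 := by field_simp; ring
  have ht' : t ^ (2 * G.nullity Finset.univ) * t ^ (2 * G.corank A)
      = t ^ (2 * G.nullity A) * t ^ (2 * (Fintype.card G.E - A.card)) := by
    rw [← pow_add, ← pow_add, ← mul_add, ← mul_add, G.nullity_univ_add_corank]
  rw [hy, add_sub_cancel_right, mul_pow, div_pow, ← pow_mul, ← pow_mul, FlagGraph.nflags, pow_add]
  have hn : t ^ (2 * G.nullity A) ≠ 0 := pow_ne_zero _ ht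
  rw [mul_div_assoc', mul_div_assoc', eq_div_iff hn]
  linear_combination -(x - 1) ^ G.corank A * (y - 1) ^ G.nullity A * t ^ G.flags * ht'
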